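/- arXiv:1007.3692 — 2 statements merged into one kernel-verified Lean document; each statement's English description precedes it below -/
import Mathlib

section
/- For all n ≥ 2, the set ∅^{nb} is a tt-cylinder: for every X ⊆ ℕ, if X ≤_tt ∅^{nb} then X ≤₁ ∅^{nb}. -/
open Classical

/-- Characteristic function of a set of naturals (values in `{0,1}`). -/
noncomputable def chi (A : Set ℕ) (n : ℕ) : ℕ := if n ∈ A then 1 else 0

/-- An acceptable enumeration `φ_e` of the partial computable functions,
via Mathlib's codes for partial recursive functions. -/
def phi (e : ℕ) : ℕ →. ℕ := (Denumerable.ofNat Nat.Partrec.Code e).eval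

/-- The initial segment of (the characteristic function of) `A` of length `n`,
as a list of naturals. -/
noncomputable def initSeg (A : Set ℕ) (n : ℕ) : List ℕ := (List.range n).map (chi A)

/-- An effective enumeration `Φ_e` of the Turing functionals: the `e`-th functional
with oracle `A` on input `x` converges iff the `e`-th partial computable function halts
on `(σ, x)` for some initial segment `σ` of `A`; its value is obtained from the least
such initial segment. -/
noncomputable def Phi (e : ℕ) (A : Set ℕ) (x : ℕ) : Part ℕ :=
  ⟨∃ n, (phi e (Nat.pair (Encodable.encode (initSeg A n)) x)).Dom,
   fun h => (phi e (Nat.pair (Encodable.encode (initSeg A (Nat.find h))) x)).get (Nat.find_spec h)⟩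

/-- `A↾n = {m ∈ A : m ≤ n}`. -/
def restrictTo (A : Set ℕ) (n : ℕ) : Set ℕ := {m | m ∈ A ∧ m ≤ n}

/-- The bounded jump `A^b = {x : ∃ i ≤ x, φ_i(x)↓ ∧ Φ_x^{A↾φ_i(x)}(x)↓}`. -/
def bJump (A : Set ℕ) : Set ℕ :=
  {x | ∃ i ≤ x, ∃ h : (phi i x).Dom, (Phi x (restrictTo A ((phi i x).get h)) x).Dom}

/-- `A^{b₀} = {⟨e,i,j⟩ : φ_i(j)↓ ∧ Φ_e^{A↾φ_i(j)}(j)↓}`, coding triples with `Nat.pair`. -/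
def b0Jump (A : Set ℕ) : Set ℕ :=
  {n | ∃ e i j, n = Nat.pair e (Nat.pair i j) ∧
        ∃ h : (phi i j).Dom, (Phi e (restrictTo A ((phi i j).get h)) j).Dom}

/-- The simple jump `A^i = {x : Φ_x^{A↾x}(x)↓}`. -/
def iJump (A : Set ℕ) : Set ℕ := {x | (Phi x (restrictTo A x) x).Dom}

/-- `∅^{nb}`, the `n`-th iterate of the bounded jump of the empty set. -/
def bIter : ℕ → Set ℕ
  | 0 => (∅ : Set ℕ)
  | n + 1 => bJump (bIter n)

/-- The halting set `∅′ = {x : φ_x(x)↓}`. -/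
def K : Set ℕ := {x | (phi x x).Dom}

/-- The effective join `A ⊕ B = {2n : n ∈ A} ∪ {2n+1 : n ∈ B}`. -/
def join (A B : Set ℕ) : Set ℕ :=
  {n | (∃ m ∈ A, n = 2 * m) ∨ (∃ m ∈ B, n = 2 * m + 1)}

/-- `X ≤₁ Y`: one-reducibility via a total computable injection. -/
def oneReducible (X Y : Set ℕ) : Prop :=
  ∃ f : ℕ → ℕ, Computable f ∧ Function.Injective f ∧ ∀ x, x ∈ X ↔ f x ∈ Y

/-- `X ≤_bT Y`: bounded Turing (weak truth-table) reducibility. There are indices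
`e, j` with `φ_j` total such that `X(x) = Φ_e^{Y↾φ_j(x)}(x)` for all `x`. -/
def bTReducible (X Y : Set ℕ) : Prop :=
  ∃ e j, ∃ h : ∀ x, (phi j x).Dom,
    ∀ x, Phi e (restrictTo Y ((phi j x).get (h x))) x = Part.some (chi X x)

/-- `X ≤_T Y`: Turing reducibility. -/
def TReducible (X Y : Set ℕ) : Prop :=
  ∃ e, ∀ x, Phi e Y x = Part.some (chi X x)

/-- `X ≤_tt Y`: truth-table reducibility, i.e. Turing reducibility via a functional
that is total on all oracles. -/
def ttReducible (X Y : Set ℕ) : Prop :=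
  ∃ e, (∀ B : Set ℕ, ∀ x, (Phi e B x).Dom) ∧ ∀ x, Phi e Y x = Part.some (chi X x)

/-- `A` is `ω^k`-c.e.: ordinals below `ω^k` are coded by their lists of Cantor normal
form coefficients (length-`k` lists of naturals, most significant first), ordered
lexicographically.  There is a partial computable `ψ : ℕ × ω^k → {0,1}` such that for
every `n` some `ψ(n,β)` converges, and `A(n) = ψ(n,γ)` for the least converging `γ`. -/
def OmegaCE (k : ℕ) (A : Set ℕ) : Prop :=
  ∃ ψ : ℕ →. ℕ, Partrec ψ ∧ (∀ m y, y ∈ ψ m → y ≤ 1) ∧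
    ∀ n : ℕ, ∃ l : List ℕ, l.length = k ∧
      (∀ l' : List ℕ, l'.length = k → List.Lex (· < ·) l' l →
        ¬ (ψ (Nat.pair n (Encodable.encode l'))).Dom) ∧
      chi A n ∈ ψ (Nat.pair n (Encodable.encode l))

/-- The (lightface) `Σ_n` sets of naturals. -/
def SigmaN : ℕ → Set ℕ → Prop
  | 0 => fun S => ComputablePred (· ∈ S)
  | n + 1 => fun S => ∃ R : Set ℕ, SigmaN n R ∧ S = {x | ∃ y, Nat.pair x y ∉ R}

/-- The initial segment of `A` of length `n`, as a finite binary string. -/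
noncomputable def initSegB (A : Set ℕ) (n : ℕ) : List Bool :=
  (List.range n).map fun i => decide (i ∈ A)

/-- `A` is `n`-generic: for every `Σ_n` set `S` of (codes of) finite binary strings,
either some initial segment of `A` is in `S`, or some initial segment of `A` has no
extension in `S`. -/
def NGeneric (n : ℕ) (A : Set ℕ) : Prop :=
  ∀ S : Set ℕ, SigmaN n S →
    (∃ l, Encodable.encode (initSegB A l) ∈ S) ∨
    (∃ l, ∀ τ : List Bool, initSegB A l <+: τ → Encodable.encode τ ∉ S)

/-- The open subset of Cantor space generated by the set of strings `U` has measure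
`≤ 2^{-i}`: for every `n`, at most `2^n/2^i` strings of length `n` extend a string
of `U`. -/
def stringMeasureLe (U : Set (List Bool)) (i : ℕ) : Prop :=
  ∀ n : ℕ, ({σ : List Bool | σ.length = n ∧ ∃ τ ∈ U, τ <+: σ}.ncard) * 2 ^ i ≤ 2 ^ n

/-- `A` is `n`-random: for every uniformly `Σ_n` family `⟨U_i⟩` of sets of (codes of)
finite binary strings with `μ(U_i) ≤ 2^{-i}`, there is an `l` such that no initial
segment of `A` lies in `U_l`. -/
def NRandom (n : ℕ) (A : Set ℕ) : Prop :=
  ∀ U : Set ℕ, SigmaN n U →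
    (∀ i, stringMeasureLe {σ : List Bool | Nat.pair i (Encodable.encode σ) ∈ U} i) →
    ∃ l, ∀ m, Nat.pair l (Encodable.encode (initSegB A m)) ∉ U

/-- The code `c` codes a tt-condition (a finite sequence of positions together with a
truth table) satisfied by `A`. -/
def ttSatisfied (A : Set ℕ) (c : ℕ) : Prop :=
  ∃ p : List ℕ × List Bool, Encodable.decode c = some p ∧
    p.2.length = 2 ^ p.1.length ∧
    p.2.getD (p.1.foldr (fun x acc => 2 * acc + chi A x) 0) false = true

/-- `A^{tt}`: the set of codes of tt-conditions satisfied by `A`. -/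
def ttSet (A : Set ℕ) : Set ℕ := {c | ttSatisfied A c}

/-- Gerla's truth-table jump `A_tt = {x : φ_x(x)↓ ∧ φ_x(x) ∈ A^{tt}}`. -/
def gerlaJump (A : Set ℕ) : Set ℕ :=
  {x | ∃ h : (phi x x).Dom, (phi x x).get h ∈ ttSet A}

open Nat.Partrec (Code)

attribute [fun_prop] Computable Computable.id Computable.const Computable.comp Computable.pair
  Computable.fst Computable.snd

theorem Nat.pair_le_pair {a b a' b' : ℕ} (ha : a ≤ a') (hb : b ≤ b') :
    Nat.pair a b ≤ Nat.pair a' b' :=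
  (StrictMono.monotone (f := fun c => Nat.pair c b) (fun _ _ => Nat.pair_lt_pair_left b) ha).trans
    (StrictMono.monotone (f := Nat.pair a') (fun _ _ => Nat.pair_lt_pair_right a') hb)

namespace Computable

variable {α β : Type*} [Primcodable α] [Primcodable β]

@[fun_prop]
theorem encode' {f : α → β} (hf : Computable f) : Computable fun a => Encodable.encode (f a) :=
  Computable.encode.comp hf

@[fun_prop]
theorem natPair {f g : α → ℕ} (hf : Computable f) (hg : Computable g) :
    Computable fun a => Nat.pair (f a) (g a) :=
  Primrec₂.natPair.to_comp.comp hf hg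

@[fun_prop]
theorem natUnpair {f : α → ℕ} (hf : Computable f) : Computable fun a => Nat.unpair (f a) :=
  Computable.unpair.comp hf

@[fun_prop]
theorem natAdd {f g : α → ℕ} (hf : Computable f) (hg : Computable g) :
    Computable fun a => f a + g a :=
  Primrec.nat_add.to_comp.comp hf hg

@[fun_prop]
theorem natMod {f g : α → ℕ} (hf : Computable f) (hg : Computable g) :
    Computable fun a => f a % g a :=
  Primrec.nat_mod.to_comp.comp hf hg

theorem primrec_pow : Primrec₂ ((· ^ ·) : ℕ → ℕ → ℕ) :=
  Primrec₂.unpaired'.1 Nat.Primrec.pow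

@[fun_prop]
theorem natPow {f g : α → ℕ} (hf : Computable f) (hg : Computable g) :
    Computable fun a => f a ^ g a :=
  primrec_pow.to_comp.comp hf hg

theorem primrec_testBit : Primrec₂ Nat.testBit :=
  ((Primrec.eq.comp (Primrec.nat_mod.comp (Primrec.nat_div.comp Primrec.fst
    (primrec_pow.comp (Primrec.const 2) Primrec.snd)) (Primrec.const 2))
      (Primrec.const 1)).decide).of_eq fun p => by
    rw [Nat.testBit_eq_decide_div_mod_eq]

@[fun_prop]
theorem natTestBit {f g : α → ℕ} (hf : Computable f) (hg : Computable g) :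
    Computable fun a => Nat.testBit (f a) (g a) :=
  primrec_testBit.to_comp.comp hf hg

/-- Every computable function on `ℕ` has a computable majorant. -/
theorem exists_majorant {f : ℕ → ℕ} (hf : Computable f) :
    ∃ F : ℕ → ℕ, Computable F ∧ ∀ k n, k ≤ n → f k ≤ F n := by
  refine ⟨fun n => Nat.rec (f 0) (fun k s => s + f (k + 1)) n,
    Computable.nat_rec Computable.id (Computable.const (f 0))
      (h := fun _ p => p.2 + f (p.1 + 1)) (Computable₂.mk (by fun_prop)), fun k n h => ?_⟩
  induction n with
  | zero => simp_all
  | succ n ih =>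
    rcases Nat.le_succ_iff.1 h with h | rfl
    · exact (ih h).trans (Nat.le_add_right _ _)
    · exact Nat.le_add_left _ _

theorem exists_majorant₃ {f : ℕ × ℕ × ℕ → ℕ} (hf : Computable f) :
    ∃ F : ℕ × ℕ × ℕ → ℕ, Computable F ∧
      ∀ a b c a' b' c', a ≤ a' → b ≤ b' → c ≤ c' → f (a, b, c) ≤ F (a', b', c') := by
  obtain ⟨F, hF, h⟩ := exists_majorant (f := fun n => f (n.unpair.1, n.unpair.2.unpair))
    (by fun_prop)
  refine ⟨fun p => F (Nat.pair p.1 (Nat.pair p.2.1 p.2.2)), by fun_prop,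
    fun a b c a' b' c' ha hb hc => ?_⟩
  simpa using h _ _ (Nat.pair_le_pair ha (Nat.pair_le_pair hb hc))

end Computable

namespace REPred

variable {α β : Type*} [Primcodable α] [Primcodable β] {p q : α → Prop}

theorem comp {p : β → Prop} (hp : REPred p) {f : α → β} (hf : Computable f) :
    REPred fun a => p (f a) :=
  Partrec.comp hp hf

/-- An r.e. predicate is the domain of the evaluation of some code. -/
theorem exists_code {p : α → Prop} (hp : REPred p) :
    ∃ c : Code, ∀ a, p a ↔ (c.eval (Encodable.encode a)).Dom := by
  obtain ⟨c, hc⟩ := Code.exists_code.1 hp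
  refine ⟨c, fun a => ?_⟩
  rw [hc]
  simp [Part.assert]

/-- An r.e. predicate is the increasing union of a uniformly primitive recursive family. -/
theorem exists_stages (hp : REPred p) :
    ∃ r : α → ℕ → Prop, PrimrecRel r ∧ (∀ a s t, s ≤ t → r a s → r a t) ∧
      ∀ a, p a ↔ ∃ s, r a s := by
  obtain ⟨c, hc⟩ := hp.exists_code
  refine ⟨fun a s => (c.evaln s (Encodable.encode a)).isSome = true, ?_, ?_, ?_⟩
  · exact Primrec.eq.comp (Primrec.option_isSome.comp (Code.primrec_evaln.comp
      ((Primrec.snd.pair (Primrec.const c)).pair (Primrec.encode.comp Primrec.fst))))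
      (Primrec.const true)
  · intro a s t hst h
    obtain ⟨v, hv⟩ := Option.isSome_iff_exists.1 h
    exact Option.isSome_iff_exists.2 ⟨v, Code.evaln_mono hst hv⟩
  · intro a
    rw [hc, Part.dom_iff_mem]
    simp only [Code.evaln_complete, Option.isSome_iff_exists, Option.mem_def]
    exact exists_comm

theorem of_exists_primrec {r : α → ℕ → Prop} (hr : PrimrecRel r) :
    REPred fun a => ∃ s, r a s := by
  have h : Partrec fun a => Nat.rfind fun n => Part.some (decide (r a n)) :=
    Partrec.rfind (Primrec.to_comp hr.decide).partrec
  exact h.dom_re.of_eq fun a => Nat.rfind_dom'.trans (by simp)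

theorem and (hp : REPred p) (hq : REPred q) : REPred fun a => p a ∧ q a := by
  obtain ⟨r, hr, mr, er⟩ := hp.exists_stages
  obtain ⟨t, ht, mt, et⟩ := hq.exists_stages
  refine (of_exists_primrec (r := fun a s => r a s ∧ t a s)
    (PrimrecPred.and hr ht)).of_eq fun a => ?_
  rw [er, et]
  constructor
  · rintro ⟨s, h₁, h₂⟩
    exact ⟨⟨s, h₁⟩, s, h₂⟩
  · rintro ⟨⟨s, h₁⟩, s', h₂⟩
    exact ⟨max s s', mr _ _ _ (le_max_left _ _) h₁, mt _ _ _ (le_max_right _ _) h₂⟩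

theorem or (hp : REPred p) (hq : REPred q) : REPred fun a => p a ∨ q a := by
  obtain ⟨r, hr, mr, er⟩ := hp.exists_stages
  obtain ⟨t, ht, mt, et⟩ := hq.exists_stages
  refine (of_exists_primrec (r := fun a s => r a s ∨ t a s)
    (PrimrecPred.or hr ht)).of_eq fun a => ?_
  rw [er, et, exists_or]

theorem exists_nat {p : α → ℕ → Prop} (hp : REPred fun x : α × ℕ => p x.1 x.2) :
    REPred fun a => ∃ n, p a n := by
  obtain ⟨r, hr, -, er⟩ := hp.exists_stages
  have h : PrimrecRel fun (a : α) (s : ℕ) => r (a, s.unpair.1) s.unpair.2 :=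
    hr.comp (Primrec.fst.pair (Primrec.fst.comp (Primrec.unpair.comp Primrec.snd)))
      (Primrec.snd.comp (Primrec.unpair.comp Primrec.snd))
  refine (of_exists_primrec h).of_eq fun a => ?_
  constructor
  · rintro ⟨s, h⟩
    exact ⟨_, (er _).2 ⟨_, h⟩⟩
  · rintro ⟨n, h⟩
    obtain ⟨s, hs⟩ := (er (a, n)).1 h
    exact ⟨Nat.pair n s, by simpa using hs⟩

theorem forall_lt {p : α → ℕ → Prop} {b : α → ℕ} (hb : Computable b)
    (hp : REPred fun x : α × ℕ => p x.1 x.2) : REPred fun a => ∀ n < b a, p a n := by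
  obtain ⟨r, hr, mr, er⟩ := hp.exists_stages
  have h₀ : PrimrecRel fun (n : ℕ) (y : (α × ℕ) × ℕ) => r (y.1.1, n) y.2 :=
    hr.comp ((Primrec.fst.comp (Primrec.fst.comp Primrec.snd)).pair Primrec.fst)
      (Primrec.snd.comp Primrec.snd)
  have h : PrimrecRel fun (x : α × ℕ) (s : ℕ) => ∀ n ∈ List.range x.2, r (x.1, n) s :=
    h₀.forall_mem_list.comp (Primrec.list_range.comp (Primrec.snd.comp Primrec.fst)) Primrec.id
  refine ((of_exists_primrec h).comp (Computable.id.pair hb)).of_eq fun a => ?_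
  simp only [List.mem_range, id]
  constructor
  · rintro ⟨s, h⟩ n hn
    exact (er _).2 ⟨s, h n hn⟩
  · intro h
    have h' : ∀ n, ∃ s, n < b a → r (a, n) s := fun n => by
      by_cases hn : n < b a
      · exact ((er _).1 (h n hn)).imp fun s hs _ => hs
      · exact ⟨0, fun h => absurd h hn⟩
    choose s hs using h'
    exact ⟨(Finset.range (b a)).sup s, fun n hn =>
      mr _ _ _ (Finset.le_sup (Finset.mem_range.2 hn)) (hs n hn)⟩

theorem of_bool {f : α → Bool} (hf : Computable f) (v : Bool) : REPred fun a => f a = v :=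
  ComputablePred.to_re <| Computable.computablePred <|
    (Primrec.eq.decide.to_comp.comp hf (Computable.const v)).of_eq fun _ => rfl

theorem nat_le {f g : α → ℕ} (hf : Computable f) (hg : Computable g) : REPred fun a => f a ≤ g a :=
  ComputablePred.to_re <| Computable.computablePred <| Primrec.nat_le.decide.to_comp.comp hf hg

theorem nat_eq {f g : α → ℕ} (hf : Computable f) (hg : Computable g) : REPred fun a => f a = g a :=
  ComputablePred.to_re <| Computable.computablePred <| Primrec.eq.decide.to_comp.comp hf hg

/-- Uniformization of r.e. relations by computable functions. -/
theorem exists_computable {p : α → ℕ → Prop} (hp : REPred fun x : α × ℕ => p x.1 x.2)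
    (h : ∀ a, ∃ n, p a n) : ∃ u : α → ℕ, Computable u ∧ ∀ a, p a (u a) := by
  obtain ⟨r, hr, -, er⟩ := hp.exists_stages
  have hr' : PrimrecPred fun x : α × ℕ => r (x.1, x.2.unpair.1) x.2.unpair.2 :=
    hr.comp (Primrec.fst.pair (Primrec.fst.comp (Primrec.unpair.comp Primrec.snd)))
      (Primrec.snd.comp (Primrec.unpair.comp Primrec.snd))
  have hex : ∀ a, ∃ n : ℕ, r (a, n.unpair.1) n.unpair.2 := fun a => by
    obtain ⟨n, hn⟩ := h a
    obtain ⟨s, hs⟩ := (er (a, n)).1 hn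
    exact ⟨Nat.pair n s, by simpa using hs⟩
  have hfind := Computable.find (P := fun a n => r (a, n.unpair.1) n.unpair.2)
    hr'.computablePred hex
  exact ⟨fun a => (Nat.find (hex a)).unpair.1, by fun_prop,
    fun a => (er (a, _)).2 ⟨_, Nat.find_spec (hex a)⟩⟩

end REPred

/-- The finite set coded by the binary expansion of `b`. -/
def bitSet (b : ℕ) : Set ℕ := {j | b.testBit j = true}

/-- The initial segment of length `n` of the finite set coded by `b`. -/
def bitSeg (b n : ℕ) : List ℕ := (List.range n).map fun j => (b.testBit j).toNat

@[fun_prop]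
theorem computable_bitSeg {α : Type*} [Primcodable α] {f g : α → ℕ} (hf : Computable f)
    (hg : Computable g) : Computable fun a => bitSeg (f a) (g a) := by
  have h : Primrec₂ bitSeg :=
    Primrec.list_map (Primrec.list_range.comp Primrec.snd)
      ((Primrec.dom_bool Bool.toNat).comp
        (Computable.primrec_testBit.comp (Primrec.fst.comp Primrec.fst) Primrec.snd))
  exact h.to_comp.comp hf hg

theorem initSeg_eq_bitSeg_iff (B : Set ℕ) (b n m : ℕ) :
    initSeg B n = bitSeg b m ↔ n = m ∧ ∀ j < n, (b.testBit j = true ↔ j ∈ B) := by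
  constructor
  · intro h
    have hl : n = m := by simpa [initSeg, bitSeg] using congrArg List.length h
    subst hl
    refine ⟨rfl, fun j hj => ?_⟩
    have := List.map_inj_left.1 h j (List.mem_range.2 hj)
    by_cases hB : j ∈ B <;> cases hb : b.testBit j <;> simp_all [chi]
  · rintro ⟨rfl, h⟩
    refine List.map_inj_left.2 fun j hj => ?_
    have := h j (List.mem_range.1 hj)
    by_cases hB : j ∈ B <;> cases hb : b.testBit j <;> simp_all [chi]

theorem initSeg_bitSet (b n : ℕ) : initSeg (bitSet b) n = bitSeg b n :=
  (initSeg_eq_bitSeg_iff _ _ _ _).2 ⟨rfl, fun _ _ => Iff.rfl⟩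

theorem exists_bits (A : Set ℕ) (n : ℕ) :
    ∃ b < 2 ^ n, ∀ j < n, (b.testBit j = true ↔ j ∈ A) := by
  refine ⟨Nat.ofBits fun i : Fin n => decide ((i : ℕ) ∈ A), Nat.ofBits_lt_two_pow _,
    fun j hj => ?_⟩
  rw [Nat.testBit_ofBits_lt _ _ hj]
  simp

theorem bitSet_mod (A : Set ℕ) (b m v : ℕ) (h : ∀ j ≤ m, (b.testBit j = true ↔ j ∈ A))
    (hv : v ≤ m) : bitSet (b % 2 ^ (v + 1)) = restrictTo A v := by
  ext j
  simp only [bitSet, restrictTo, Set.mem_ofPred_eq, Nat.testBit_mod_two_pow, Bool.and_eq_true,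
    decide_eq_true_eq, Nat.lt_succ_iff]
  constructor
  · rintro ⟨hj, hb⟩
    exact ⟨(h j (hj.trans hv)).1 hb, hj⟩
  · rintro ⟨hA, hj⟩
    exact ⟨hj, (h j (hj.trans hv)).2 hA⟩

theorem mem_Phi_iff (e : ℕ) (B : Set ℕ) (x v : ℕ) :
    v ∈ Phi e B x ↔ ∃ n, v ∈ phi e (Nat.pair (Encodable.encode (initSeg B n)) x) ∧
      ∀ n' < n, ¬ (phi e (Nat.pair (Encodable.encode (initSeg B n')) x)).Dom := by
  constructor
  · rintro ⟨h, rfl⟩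
    exact ⟨Nat.find h, Part.get_mem _, fun n' hn' => Nat.find_min h hn'⟩
  · rintro ⟨n, hv, hn⟩
    have h : ∃ n, (phi e (Nat.pair (Encodable.encode (initSeg B n)) x)).Dom :=
      ⟨n, Part.dom_iff_mem.2 ⟨v, hv⟩⟩
    have hfind : Nat.find h = n := (Nat.find_eq_iff h).2 ⟨Part.dom_iff_mem.2 ⟨v, hv⟩, hn⟩
    exact ⟨h, Part.get_eq_of_mem
      (o := phi e (Nat.pair (Encodable.encode (initSeg B (Nat.find h))) x)) (by rwa [hfind]) _⟩

theorem mem_bJump_iff (A : Set ℕ) (y : ℕ) :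
    y ∈ bJump A ↔ ∃ i ≤ y, ∃ v ∈ phi i y, (Phi y (restrictTo A v) y).Dom := by
  constructor
  · rintro ⟨i, hi, h, hP⟩
    exact ⟨i, hi, _, Part.get_mem h, hP⟩
  · rintro ⟨i, hi, v, ⟨h, rfl⟩, hP⟩
    exact ⟨i, hi, h, hP⟩

theorem phi_encode (c : Code) : phi (Encodable.encode c) = c.eval := by
  simp [phi]

theorem zero_mem_phi_zero (x : ℕ) : 0 ∈ phi 0 x := by
  have h : Encodable.encode Code.zero = 0 := rfl
  rw [← h, phi_encode]
  exact Part.mem_some 0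

theorem repred_mem_phi {α : Type*} [Primcodable α] {f g h : α → ℕ} (hf : Computable f)
    (hg : Computable g) (hh : Computable h) : REPred fun a => h a ∈ phi (f a) (g a) := by
  have key : REPred fun p : ℕ × ℕ × ℕ => p.2.2 ∈ phi p.1 p.2.1 := by
    refine (REPred.of_exists_primrec (r := fun (p : ℕ × ℕ × ℕ) k =>
      (Denumerable.ofNat Code p.1).evaln k p.2.1 = some p.2.2) ?_).of_eq fun p =>
        Code.evaln_complete.symm
    exact Primrec.eq.comp (Code.primrec_evaln.comp
      ((Primrec.snd.pair ((Primrec.ofNat Code).comp (Primrec.fst.comp Primrec.fst))).pair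
        (Primrec.fst.comp (Primrec.snd.comp Primrec.fst))))
      (Primrec.option_some.comp (Primrec.snd.comp (Primrec.snd.comp Primrec.fst)))
  exact key.comp (hf.pair (hg.pair hh))

theorem repred_phi_dom {α : Type*} [Primcodable α] {f g : α → ℕ} (hf : Computable f)
    (hg : Computable g) : REPred fun a => (phi (f a) (g a)).Dom :=
  (REPred.exists_nat (p := fun a v => v ∈ phi (f a) (g a))
    (repred_mem_phi (by fun_prop) (by fun_prop) (by fun_prop))).of_eq
      fun _ => Part.dom_iff_mem.symm

theorem repred_Phi_bitSet_dom {α : Type*} [Primcodable α] {f g h : α → ℕ} (hf : Computable f)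
    (hg : Computable g) (hh : Computable h) :
    REPred fun a => (Phi (f a) (bitSet (g a)) (h a)).Dom := by
  refine (REPred.exists_nat (p := fun a n =>
    (phi (f a) (Nat.pair (Encodable.encode (bitSeg (g a) n)) (h a))).Dom)
      (repred_phi_dom (by fun_prop) (by fun_prop))).of_eq fun a => ?_
  simp only [← initSeg_bitSet]
  rfl

/-- Compactness: a functional that is total on all oracles has uniformly bounded use. -/
theorem exists_use_bound (P : List ℕ → Prop) (h : ∀ B : Set ℕ, ∃ n, P (initSeg B n)) :
    ∃ u, ∀ b < 2 ^ u, ∃ n ≤ u, P (bitSeg b n) := by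
  let S (B : ℕ → Bool) : Set ℕ := {j | B j = true}
  have hopen : ∀ n, IsOpen {B : ℕ → Bool | P (initSeg (S B) n)} := fun n => by
    have : {B : ℕ → Bool | P (initSeg (S B) n)} = (fun B (i : Fin n) => B i) ⁻¹'
        {c : Fin n → Bool | ∃ B : ℕ → Bool, (∀ i : Fin n, B i = c i) ∧ P (initSeg (S B) n)} := by
      ext B
      refine ⟨fun hB => ⟨B, fun _ => rfl, hB⟩, ?_⟩
      rintro ⟨B', hB', hP⟩
      have : initSeg (S B) n = initSeg (S B') n := List.map_inj_left.2 fun j hj => by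
        have := hB' ⟨j, List.mem_range.1 hj⟩
        simp_all [chi, S]
      simpa [this] using hP
    rw [this]
    exact (isOpen_discrete _).preimage (by fun_prop)
  obtain ⟨t, ht⟩ := isCompact_univ.elim_finite_subcover _ hopen fun B _ =>
    Set.mem_iUnion.2 (h (S B))
  refine ⟨t.sup id, fun b _ => ?_⟩
  obtain ⟨n, hn, hP⟩ := Set.mem_iUnion₂.1 (ht (Set.mem_univ fun j => b.testBit j))
  refine ⟨n, Finset.le_sup (f := id) hn, ?_⟩
  rw [← initSeg_bitSet]
  exact hP

theorem le_encode_const (n : ℕ) : n ≤ Encodable.encode (Code.const n) := by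
  induction n with
  | zero => exact Nat.zero_le _
  | succ n ih => exact ih.trans_lt (Code.encode_lt_comp Code.succ (Code.const n)).2

theorem le_encode_curry (c : Code) (n : ℕ) : n ≤ Encodable.encode (c.curry n) :=
  (le_encode_const n).trans
    ((Code.encode_lt_pair _ _).1.trans (Code.encode_lt_comp _ _).2).le

/-- A bounded jump computes a many-one reduction of every r.e. predicate to it. -/
theorem REPred.exists_reduction {α : Type*} [Primcodable α] {p : α → Prop} (hp : REPred p)
    (C : Set ℕ) : ∃ g : α → ℕ, Computable g ∧ ∀ a, p a ↔ g a ∈ bJump C := by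
  have hp' : REPred fun n : ℕ => ∃ a ∈ (Encodable.decode n.unpair.1 : Option α), p a := by
    have h : Partrec fun n : ℕ => ((Encodable.decode n.unpair.1 : Option α) : Part α).bind
        fun a => Part.assert (p a) fun _ => Part.some () :=
      Partrec.bind (Computable.ofOption (Computable.decode.comp (by fun_prop)))
        (Partrec.comp hp Computable.snd)
    exact h.dom_re.of_eq fun n => by
      rcases (Encodable.decode n.unpair.1 : Option α) with _ | a <;> simp [Part.assert]
  obtain ⟨c, hc⟩ := hp'.exists_code
  refine ⟨fun a => Encodable.encode (c.curry (Encodable.encode a)),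
    Computable.encode.comp (Code.primrec₂_curry.to_comp.comp (Computable.const c)
      Computable.encode), fun a => ?_⟩
  have key : ∀ w, (phi (Encodable.encode (c.curry (Encodable.encode a))) w).Dom ↔ p a :=
    fun w => by
      rw [phi_encode, Code.eval_curry]
      exact (hc (Nat.pair (Encodable.encode a) w)).symm.trans (by simp)
  rw [mem_bJump_iff]
  constructor
  · exact fun h => ⟨0, Nat.zero_le _, 0, zero_mem_phi_zero _, 0, (key _).2 h⟩
  · rintro ⟨_, _, _, _, n, h⟩
    exact (key _).1 h

theorem exists_unbounded_mem_bJump (C : Set ℕ) :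
    ∃ z : ℕ → ℕ, Computable z ∧ ∀ k, k ≤ z k ∧ z k ∈ bJump C := by
  refine ⟨fun k => Encodable.encode (Code.const k),
    (Primrec.encode.comp Code.primrec_const).to_comp, fun k => ⟨le_encode_const k, ?_⟩⟩
  refine (mem_bJump_iff _ _).2 ⟨0, Nat.zero_le _, 0, zero_mem_phi_zero _, 0, ?_⟩
  rw [phi_encode, Code.eval_const]
  trivial

/-- An r.e. approximation from above to membership of `y` in the bounded jump of an oracle whose
first `L` bits are those of `t`. -/
def BJumpApprox (y t L : ℕ) : Prop :=
  ∃ i, i ≤ y ∧ ∃ v, v ∈ phi i y ∧ (L ≤ v ∨ (Phi y (bitSet (t % 2 ^ (v + 1))) y).Dom)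

theorem repred_bJumpApprox : REPred fun p : ℕ × ℕ × ℕ => BJumpApprox p.1 p.2.1 p.2.2 := by
  refine REPred.exists_nat (REPred.and (REPred.nat_le (by fun_prop) (by fun_prop))
    (REPred.exists_nat (REPred.and (repred_mem_phi (by fun_prop) (by fun_prop) (by fun_prop))
      (REPred.or (REPred.nat_le (by fun_prop) (by fun_prop))
        (repred_Phi_bitSet_dom (by fun_prop) (by fun_prop) (by fun_prop))))))

/-- The first `m + 1` bits of `a`, read as an initial segment of an oracle `A`, certify that the
functional with index `e` and oracle `bJump A` takes the value `1` at `x`. Here `g₁` and `g₂` are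
reductions to `A` of `BJumpApprox` and of the convergence of that functional. -/
def Certifies (e : ℕ) (g₁ g₂ : ℕ × ℕ × ℕ → ℕ) (x a m : ℕ) : Prop :=
  ∃ L, L ≤ m + 1 ∧ ∃ b n, 1 ∈ phi e (Nat.pair (Encodable.encode (bitSeg b n)) x) ∧
    (∀ n' < n, g₂ (x, b, n') ≤ m ∧ a.testBit (g₂ (x, b, n')) = false) ∧
    ∀ y < n,
      (b.testBit y = true ∧ ∃ i, i ≤ y ∧ ∃ v, v ∈ phi i y ∧ v ≤ m ∧
        (Phi y (bitSet (a % 2 ^ (v + 1))) y).Dom) ∨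
      (b.testBit y = false ∧ g₁ (y, a % 2 ^ L, L) ≤ m ∧ a.testBit (g₁ (y, a % 2 ^ L, L)) = false)

theorem repred_certifies (e : ℕ) {g₁ g₂ : ℕ × ℕ × ℕ → ℕ} (h₁ : Computable g₁)
    (h₂ : Computable g₂) : REPred fun p : ℕ × ℕ × ℕ => Certifies e g₁ g₂ p.1 p.2.1 p.2.2 := by
  refine REPred.exists_nat (REPred.and (REPred.nat_le (by fun_prop) (by fun_prop))
    (REPred.exists_nat (REPred.exists_nat (REPred.and
      (repred_mem_phi (by fun_prop) (by fun_prop) (by fun_prop)) (REPred.and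
        (REPred.forall_lt (by fun_prop) (REPred.and (REPred.nat_le (by fun_prop) (by fun_prop))
          (REPred.of_bool (by fun_prop) _)))
        (REPred.forall_lt (by fun_prop) (REPred.or
          (REPred.and (REPred.of_bool (by fun_prop) _) (REPred.exists_nat (REPred.and
            (REPred.nat_le (by fun_prop) (by fun_prop)) (REPred.exists_nat (REPred.and
              (repred_mem_phi (by fun_prop) (by fun_prop) (by fun_prop)) (REPred.and
                (REPred.nat_le (by fun_prop) (by fun_prop))
                (repred_Phi_bitSet_dom (by fun_prop) (by fun_prop) (by fun_prop))))))))
          (REPred.and (REPred.of_bool (by fun_prop) _) (REPred.and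
            (REPred.nat_le (by fun_prop) (by fun_prop))
            (REPred.of_bool (by fun_prop) _))))))))))

theorem bitSet_mod_mod {a L v : ℕ} (h : v < L) :
    bitSet (a % 2 ^ L % 2 ^ (v + 1)) = bitSet (a % 2 ^ (v + 1)) := by
  rw [Nat.mod_mod_of_dvd _ (pow_dvd_pow 2 h)]

/-- A bound on the convergent values `φ_i(y)` with `i, y ≤ u` that is itself such a value. -/
theorem exists_max_phi (u : ℕ) : ∃ i ≤ u, ∃ y ≤ u, ∃ v ∈ phi i y,
    ∀ i' ≤ u, ∀ y' ≤ u, ∀ v' ∈ phi i' y', v' ≤ v := by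
  let S : Set ℕ := {v | ∃ i ≤ u, ∃ y ≤ u, v ∈ phi i y}
  have hfin : S.Finite := by
    have : S ⊆ ⋃ i ∈ Set.Iic u, ⋃ y ∈ Set.Iic u, {v | v ∈ phi i y} := by
      rintro v ⟨i, hi, y, hy, hv⟩
      exact Set.mem_biUnion hi (Set.mem_biUnion hy hv)
    refine Set.Finite.subset ((Set.finite_Iic u).biUnion fun i _ =>
      (Set.finite_Iic u).biUnion fun y _ => Set.Subsingleton.finite ?_) this
    exact fun v hv w hw => Part.mem_unique hv hw
  obtain ⟨v, ⟨i, hi, y, hy, hv⟩, hmax⟩ := hfin.exists_maximal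
    ⟨0, 0, Nat.zero_le _, 0, Nat.zero_le _, zero_mem_phi_zero 0⟩
  refine ⟨i, hi, y, hy, v, hv, fun i' hi' y' hy' v' hv' => ?_⟩
  rcases le_total v' v with h | h
  · exact h
  · exact hmax ⟨i', hi', y', hy', hv'⟩ h

theorem Certifies.one_mem {A : Set ℕ} {e : ℕ} {g₁ g₂ : ℕ × ℕ × ℕ → ℕ} {x a m : ℕ}
    (hg₁ : ∀ p : ℕ × ℕ × ℕ, BJumpApprox p.1 p.2.1 p.2.2 ↔ g₁ p ∈ A)
    (hg₂ : ∀ p : ℕ × ℕ × ℕ,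
      (phi e (Nat.pair (Encodable.encode (bitSeg p.2.1 p.2.2)) p.1)).Dom ↔ g₂ p ∈ A)
    (ha : ∀ j ≤ m, (a.testBit j = true ↔ j ∈ A))
    (h : Certifies e g₁ g₂ x a m) : 1 ∈ Phi e (bJump A) x := by
  obtain ⟨L, hL, b, n, hone, hleast, hb⟩ := h
  have ha' : ∀ j ≤ m, a.testBit j = false → j ∉ A := fun j hj hf hA => by
    simp [(ha j hj).2 hA] at hf
  have hseg : ∀ y < n, (b.testBit y = true ↔ y ∈ bJump A) := fun y hy => by
    rw [mem_bJump_iff]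
    rcases hb y hy with ⟨hby, i, hi, v, hv, hvm, hP⟩ | ⟨hby, hgm, hg⟩
    · rw [bitSet_mod A a m v ha hvm] at hP
      exact iff_of_true hby ⟨i, hi, v, hv, hP⟩
    · refine iff_of_false (by simp [hby]) ?_
      rintro ⟨i, hi, v, hv, hP⟩
      refine ha' _ hgm hg ((hg₁ _).1 ⟨i, hi, v, hv, ?_⟩)
      rcases le_or_gt L v with hLv | hLv
      · exact Or.inl hLv
      · right
        dsimp only
        rwa [bitSet_mod_mod hLv, bitSet_mod A a m v ha (by omega)]
  have hinit : ∀ n' ≤ n, initSeg (bJump A) n' = bitSeg b n' := fun n' hn' =>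
    (initSeg_eq_bitSeg_iff _ _ _ _).2 ⟨rfl, fun j hj => hseg j (by omega)⟩
  refine (mem_Phi_iff _ _ _ _).2 ⟨n, by rwa [hinit n le_rfl], fun n' hn' hdom => ?_⟩
  rw [hinit n' hn'.le] at hdom
  exact ha' _ (hleast n' hn').1 (hleast n' hn').2 ((hg₂ (x, b, n')).1 hdom)

theorem certifies_of_one_mem {A : Set ℕ} {e : ℕ} {g₁ g₂ G₁ G₂ : ℕ × ℕ × ℕ → ℕ} {x u v m a : ℕ}
    (hg₁ : ∀ p : ℕ × ℕ × ℕ, BJumpApprox p.1 p.2.1 p.2.2 ↔ g₁ p ∈ A)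
    (hg₂ : ∀ p : ℕ × ℕ × ℕ,
      (phi e (Nat.pair (Encodable.encode (bitSeg p.2.1 p.2.2)) p.1)).Dom ↔ g₂ p ∈ A)
    (hG₁ : ∀ a b c a' b' c', a ≤ a' → b ≤ b' → c ≤ c' → g₁ (a, b, c) ≤ G₁ (a', b', c'))
    (hG₂ : ∀ a b c a' b' c', a ≤ a' → b ≤ b' → c ≤ c' → g₂ (a, b, c) ≤ G₂ (a', b', c'))
    (hu : ∀ b < 2 ^ u, ∃ n ≤ u, (phi e (Nat.pair (Encodable.encode (bitSeg b n)) x)).Dom)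
    (hmax : ∀ i' ≤ u, ∀ y' ≤ u, ∀ v' ∈ phi i' y', v' ≤ v)
    (hm : v + 1 + G₁ (u, 2 ^ (v + 1), v + 1) + G₂ (x, 2 ^ u, u) ≤ m)
    (ha : ∀ j ≤ m, (a.testBit j = true ↔ j ∈ A)) (h : 1 ∈ Phi e (bJump A) x) :
    Certifies e g₁ g₂ x a m := by
  have ha' : ∀ j ≤ m, j ∉ A → a.testBit j = false := fun j hj hA => by
    by_contra hf
    exact hA ((ha j hj).1 (by simpa using hf))
  obtain ⟨n, hone, hleast⟩ := (mem_Phi_iff _ _ _ _).1 h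
  obtain ⟨b, hb, hbit⟩ := exists_bits (bJump A) u
  have hinit : ∀ n' ≤ u, initSeg (bJump A) n' = bitSeg b n' := fun n' hn' =>
    (initSeg_eq_bitSeg_iff _ _ _ _).2 ⟨rfl, fun j hj => hbit j (by omega)⟩
  have hnu : n ≤ u := by
    obtain ⟨n', hn', hdom⟩ := hu b hb
    rw [← hinit n' hn'] at hdom
    exact (not_lt.1 fun hlt => hleast n' hlt hdom).trans hn'
  refine ⟨v + 1, by omega, b, n, by rwa [← hinit n hnu], fun n' hn' => ?_, fun y hy => ?_⟩
  · have hle : g₂ (x, b, n') ≤ m :=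
      (hG₂ x b n' x (2 ^ u) u le_rfl hb.le (by omega)).trans (by omega)
    refine ⟨hle, ha' _ hle fun hA => hleast n' hn' ?_⟩
    rw [hinit n' (by omega)]
    exact (hg₂ (x, b, n')).2 hA
  · by_cases hyb : y ∈ bJump A
    · left
      refine ⟨(hbit y (by omega)).2 hyb, ?_⟩
      obtain ⟨i, hi, w, hw, hP⟩ := (mem_bJump_iff _ _).1 hyb
      have hwv := hmax i (by omega) y (by omega) w hw
      refine ⟨i, hi, w, hw, by omega, ?_⟩
      rwa [bitSet_mod A a m w ha (by omega)]
    · right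
      have hle : g₁ (y, a % 2 ^ (v + 1), v + 1) ≤ m :=
        (hG₁ y _ _ u (2 ^ (v + 1)) (v + 1) (by omega) (Nat.mod_lt _ (by positivity)).le
          le_rfl).trans (by omega)
      refine ⟨?_, hle, ha' _ hle fun hA => hyb ?_⟩
      · by_contra hf
        exact hyb ((hbit y (by omega)).1 (by simpa using hf))
      · obtain ⟨i, hi, w, hw, hP⟩ := (hg₁ _).2 hA
        have hwv := hmax i (le_trans hi (by dsimp only; omega)) y (by omega) w hw
        refine (mem_bJump_iff _ _).2 ⟨i, hi, w, hw, ?_⟩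
        rcases hP with hP | hP
        · exact absurd hP (by dsimp only; omega)
        · dsimp only at hP
          rwa [bitSet_mod_mod (by omega), bitSet_mod A a m w ha (by omega)] at hP

/-- The double bounded jump of any set is a tt-cylinder. -/
theorem ttReducible_bJump_bJump_oneReducible (C X : Set ℕ)
    (h : ttReducible X (bJump (bJump C))) : oneReducible X (bJump (bJump C)) := by
  obtain ⟨e, htot, hval⟩ := h
  have hX : ∀ x, x ∈ X ↔ 1 ∈ Phi e (bJump (bJump C)) x := fun x => by
    rw [hval]
    by_cases hx : x ∈ X <;> simp [chi, hx]
  generalize hA : bJump C = A at hX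
  obtain ⟨g₁, hg₁c, hg₁⟩ := repred_bJumpApprox.exists_reduction C
  obtain ⟨g₂, hg₂c, hg₂⟩ := (repred_phi_dom (f := fun _ : ℕ × ℕ × ℕ => e)
    (g := fun p => Nat.pair (Encodable.encode (bitSeg p.2.1 p.2.2)) p.1)
    (by fun_prop) (by fun_prop)).exists_reduction C
  obtain ⟨z, hzc, hz⟩ := exists_unbounded_mem_bJump C
  rw [hA] at hg₁ hg₂ hz
  obtain ⟨G₁, hG₁c, hG₁⟩ := Computable.exists_majorant₃ hg₁c
  obtain ⟨G₂, hG₂c, hG₂⟩ := Computable.exists_majorant₃ hg₂c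
  obtain ⟨u, huc, hu⟩ := REPred.exists_computable (p := fun x u => ∀ b < 2 ^ u, ∃ n, n ≤ u ∧
      (phi e (Nat.pair (Encodable.encode (bitSeg b n)) x)).Dom)
    (REPred.forall_lt (by fun_prop) (REPred.exists_nat (REPred.and
      (REPred.nat_le (by fun_prop) (by fun_prop)) (repred_phi_dom (by fun_prop) (by fun_prop)))))
    (fun x => exists_use_bound
      (fun l => (phi e (Nat.pair (Encodable.encode l) x)).Dom) fun B => htot B x)
  let M : ℕ × ℕ → ℕ := fun p => z (p.2 + 1 + G₁ (u p.1, 2 ^ (p.2 + 1), p.2 + 1) +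
    G₂ (p.1, 2 ^ u p.1, u p.1))
  have hMc : Computable M := by fun_prop
  -- the index `c₁.curry ⟨x, i, y⟩` computes the use bound belonging to `φ_i(y)`
  obtain ⟨c₁, hc₁⟩ : ∃ c : Code, ∀ x i y w, c.eval (Nat.pair (Nat.pair x (Nat.pair i y)) w) =
      (phi i y).map fun v => M (x, v) := by
    have hp : Partrec fun n : ℕ => (phi n.unpair.1.unpair.2.unpair.1
        n.unpair.1.unpair.2.unpair.2).map fun v => M (n.unpair.1.unpair.1, v) :=
      (Code.eval_part.comp ((Computable.ofNat Code).comp (by fun_prop)) (by fun_prop)).map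
        (Computable₂.mk (by fun_prop))
    obtain ⟨c, hc⟩ := Code.exists_code.1 (Partrec.nat_iff.1 hp)
    exact ⟨c, fun x i y w => by simp [hc]⟩
  -- the index `c₀.curry ⟨x, p⟩` searches for a certificate in its oracle
  obtain ⟨c₀, hc₀⟩ := (show REPred fun n : ℕ => ∃ a m,
      Encodable.encode (bitSeg a (m + 1)) = n.unpair.2.unpair.1 ∧ a.testBit m = true ∧
        Certifies e g₁ g₂ n.unpair.1.unpair.1 a m from
    REPred.exists_nat (REPred.exists_nat (REPred.and (REPred.nat_eq (by fun_prop) (by fun_prop))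
      (REPred.and (REPred.of_bool (by fun_prop) _) ((repred_certifies e hg₁c hg₂c).comp
        (f := fun q : (ℕ × ℕ) × ℕ => (q.1.1.unpair.1.unpair.1, q.1.2, q.2))
        (by fun_prop)))))).exists_code
  have hcurry : ∀ (c : Code) (f : ℕ → ℕ), Computable f →
      Computable fun n => Encodable.encode (c.curry (f n)) := fun c f hf =>
    Computable.encode.comp (Code.primrec₂_curry.to_comp.comp (Computable.const c) hf)
  obtain ⟨P, hPc, hP⟩ := Computable.exists_majorant (hcurry c₁ _ Computable.id)
  let f : ℕ → ℕ := fun x =>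
    Encodable.encode (c₀.curry (Nat.pair x (P (Nat.pair x (Nat.pair (u x) (u x))))))
  have hf : ∀ x σ w, (phi (f x) (Nat.pair (Encodable.encode (σ : List ℕ)) w)).Dom ↔
      ∃ a m, bitSeg a (m + 1) = σ ∧ a.testBit m = true ∧ Certifies e g₁ g₂ x a m :=
    fun x σ w => by
      rw [phi_encode, Code.eval_curry]
      have h := hc₀ (Nat.pair (Nat.pair x (P (Nat.pair x (Nat.pair (u x) (u x)))))
        (Nat.pair (Encodable.encode σ) w))
      simp only [Nat.unpair_pair, Encodable.encode_inj] at h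
      exact h.symm
  refine ⟨f, hcurry c₀ _ (by fun_prop), fun x x' hxx' => ?_, fun x => ?_⟩
  · exact (Nat.pair_eq_pair.1 (Code.curry_inj (Encodable.encode_injective hxx')).2).1
  · rw [hX, mem_bJump_iff]
    constructor
    · intro hx
      obtain ⟨i, hi, y, hy, v, hv, hmax⟩ := exists_max_phi (u x)
      obtain ⟨hm, hmA⟩ := hz (v + 1 + G₁ (u x, 2 ^ (v + 1), v + 1) + G₂ (x, 2 ^ u x, u x))
      obtain ⟨a, -, ha⟩ := exists_bits A (M (x, v) + 1)
      have hcert := certifies_of_one_mem hg₁ hg₂ hG₁ hG₂ (hu x) hmax hm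
        (fun j hj => ha j (Nat.lt_succ_of_le hj)) hx
      refine ⟨Encodable.encode (c₁.curry (Nat.pair x (Nat.pair i y))), ?_, M (x, v), ?_,
        M (x, v) + 1, (hf _ _ _).2 ⟨a, M (x, v), ?_, (ha _ (Nat.lt_succ_self _)).2 hmA, hcert⟩⟩
      · exact (hP _ _ (Nat.pair_le_pair le_rfl (Nat.pair_le_pair hi hy))).trans
          ((Nat.right_le_pair _ _).trans (le_encode_curry _ _))
      · rw [phi_encode, Code.eval_curry, hc₁]
        exact Part.mem_map _ hv
      · refine ((initSeg_eq_bitSeg_iff _ _ _ _).2 ⟨rfl, fun j hj => ?_⟩).symm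
        exact (ha j hj).trans ⟨fun h => ⟨h, Nat.lt_succ_iff.1 hj⟩, fun h => h.1⟩
    · rintro ⟨_, -, v, -, n, hn⟩
      obtain ⟨a, m, hseg, ham, hcert⟩ := (hf _ _ _).1 hn
      obtain ⟨rfl, ha⟩ := (initSeg_eq_bitSeg_iff _ _ _ _).1 hseg.symm
      have hmv : m ≤ v := ((ha m (Nat.lt_succ_self m)).1 ham).2
      exact hcert.one_mem hg₁ hg₂ fun j hj =>
        (ha j (Nat.lt_succ_of_le hj)).trans ⟨fun h => h.1, fun h => ⟨h, hj.trans hmv⟩⟩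

/-- For all `n ≥ 2`, `∅^{nb}` is a tt-cylinder. -/
theorem bIter_ttCylinder (n : ℕ) (hn : 2 ≤ n) (X : Set ℕ)
    (h : ttReducible X (bIter n)) : oneReducible X (bIter n) := by
  obtain ⟨n, rfl⟩ := Nat.exists_eq_add_of_le' hn
  exact ttReducible_bJump_bJump_oneReducible (bIter n) X h
end

section
/- ∅^{2b} is not 1-reducible to (∅^b)^{b₀}. That is, the second iterate of the bounded jump of the empty set is not 1-reducible to the b₀-jump of the halting set. -/
open Classical

open Nat.Partrec (Code)

theorem partrec₂_phi : Partrec₂ phi :=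
  Code.eval_part.comp ((Computable.ofNat Code).comp Computable.fst) Computable.snd

theorem exists_phi_eq {f : ℕ →. ℕ} (hf : Partrec f) : ∃ i, phi i = f := by
  obtain ⟨c, hc⟩ := Code.exists_code.1 (Partrec.nat_iff.1 hf)
  exact ⟨Encodable.encode c, (phi_encode c).trans hc⟩

theorem phi_zero_dom (z : ℕ) : (phi 0 z).Dom := by
  have h : phi 0 = Code.zero.eval := phi_encode Code.zero
  rw [h]
  trivial

theorem mem_bJump {A : Set ℕ} {x : ℕ} :
    x ∈ bJump A ↔ ∃ i ≤ x, ∃ v ∈ phi i x, ∃ n,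
      (phi x (Nat.pair (Encodable.encode (initSeg (restrictTo A v) n)) x)).Dom := by
  constructor
  · rintro ⟨i, hi, h, n, hn⟩
    exact ⟨i, hi, _, Part.get_mem h, n, hn⟩
  · rintro ⟨i, hi, v, ⟨h, rfl⟩, n, hn⟩
    exact ⟨i, hi, h, n, hn⟩

theorem pair_mem_b0Jump {A : Set ℕ} {e i j : ℕ} :
    Nat.pair e (Nat.pair i j) ∈ b0Jump A ↔ ∃ m ∈ phi i j, ∃ n,
      (phi e (Nat.pair (Encodable.encode (initSeg (restrictTo A m) n)) j)).Dom := by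
  constructor
  · rintro ⟨e', i', j', heq, h, n, hn⟩
    simp only [Nat.pair_eq_pair] at heq
    obtain ⟨rfl, rfl, rfl⟩ := heq
    exact ⟨_, Part.get_mem h, n, hn⟩
  · rintro ⟨m, ⟨h, rfl⟩, n, hn⟩
    exact ⟨e, i, j, rfl, h, n, hn⟩

theorem getD_initSeg (A : Set ℕ) (n k : ℕ) :
    (initSeg A n).getD k 0 = if k < n then chi A k else 0 := by
  by_cases h : k < n <;> simp [initSeg, List.getD, h]

theorem chi_eq_one {A : Set ℕ} {k : ℕ} : chi A k = 1 ↔ k ∈ A := by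
  simp [chi]

theorem chi_eq_zero {A : Set ℕ} {k : ℕ} : chi A k = 0 ↔ k ∉ A := by
  simp [chi]

theorem chi_le_one (A : Set ℕ) (k : ℕ) : chi A k ≤ 1 := by
  unfold chi
  split <;> simp

theorem chi_restrictTo_of_le {A : Set ℕ} {v k : ℕ} (h : k ≤ v) :
    chi (restrictTo A v) k = chi A k := by
  simp [chi, restrictTo, h]

theorem Nat.pair_mono {a b c d : ℕ} (h₁ : a ≤ b) (h₂ : c ≤ d) : Nat.pair a c ≤ Nat.pair b d :=
  le_trans
      ((StrictMono.monotone fun _ _ h => Nat.pair_lt_pair_left c h : Monotone (Nat.pair · c)) h₁)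
      ((StrictMono.monotone fun _ _ h => Nat.pair_lt_pair_right b h : Monotone (Nat.pair b)) h₂)

theorem encode_map_le {l : List ℕ} {g : ℕ → ℕ} (hg : ∀ k, g k ≤ 1) :
    Encodable.encode (l.map g) ≤ Encodable.encode (l.map fun _ => 1) := by
  induction l with
  | nil => rfl
  | cons a l ih =>
    simp only [List.map_cons, Encodable.encode_list_cons]
    exact Nat.succ_le_succ (Nat.pair_mono (hg a) ih)

theorem strictMono_encode_comp (a : Code) {f : ℕ → Code}
    (hf : StrictMono fun n => Encodable.encode (f n)) :
    StrictMono fun n => Encodable.encode (Code.comp a (f n)) := by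
  intro m n h
  have h₁ := Nat.pair_lt_pair_right (Encodable.encode a) (hf h)
  change 2 * (2 * Nat.pair (Encodable.encode a) (Encodable.encode (f m)) + 1) + 4 <
    2 * (2 * Nat.pair (Encodable.encode a) (Encodable.encode (f n)) + 1) + 4
  lia

theorem strictMono_encode_const : StrictMono fun n => Encodable.encode (Code.const n) :=
  strictMono_nat_of_lt_succ fun n => (Code.encode_lt_comp Code.succ (Code.const n)).2

theorem strictMono_encode_curry (c : Code) :
    StrictMono fun n => Encodable.encode (Code.curry c n) := by
  refine strictMono_encode_comp c fun m n h => ?_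
  have h₁ := Nat.pair_lt_pair_left (Encodable.encode Code.id) (strictMono_encode_const h)
  change 2 * (2 * Nat.pair (Encodable.encode (Code.const m)) (Encodable.encode Code.id)) + 4 <
    2 * (2 * Nat.pair (Encodable.encode (Code.const n)) (Encodable.encode Code.id)) + 4
  lia

/-- The halting problem reduces to `∅^b` by a strictly increasing computable function. -/
theorem exists_strictMono_reduction_halting : ∃ r : ℕ → ℕ, Computable r ∧ StrictMono r ∧
    ∀ c z, r (Nat.pair c z) ∈ bJump ∅ ↔ (phi c z).Dom := by
  have hu : Partrec fun y : ℕ => phi y.unpair.1.unpair.1 y.unpair.1.unpair.2 := by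
    have h₁ : Computable fun y : ℕ => y.unpair.1.unpair :=
      Computable.unpair.comp (Computable.fst.comp Computable.unpair)
    exact partrec₂_phi.comp (Computable.fst.comp h₁) (Computable.snd.comp h₁)
  obtain ⟨u, hu⟩ := Code.exists_code.1 (Partrec.nat_iff.1 hu)
  refine ⟨fun y => Encodable.encode (Code.curry u y), ?_, strictMono_encode_curry u, ?_⟩
  · exact Computable.encode.comp
      (Code.primrec₂_curry.comp (Primrec.const u) Primrec.id).to_comp
  · intro c z
    simp only [mem_bJump, phi_encode, Code.eval_curry, hu, Nat.unpair_pair]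
    constructor
    · rintro ⟨_, _, _, _, _, h⟩
      exact h
    · intro h
      exact ⟨0, Nat.zero_le _, _, Part.get_mem (phi_zero_dom _), 0, h⟩

/-- Kleene's recursion theorem with arbitrarily large fixed points. -/
theorem exists_ge_phi_eq {F : ℕ → ℕ →. ℕ} (hF : Partrec₂ F) (N : ℕ) :
    ∃ x ≥ N, phi x = F x := by
  let pad : Code → Code := fun c => Code.comp Code.left (Code.pair c (Code.const N))
  have hpad : Computable pad :=
    (Code.primrec₂_comp.comp (Primrec.const Code.left)
      (Code.primrec₂_pair.comp Primrec.id (Primrec.const (Code.const N)))).to_comp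
  have hF' : Partrec₂ fun (c : Code) (y : ℕ) => F (Encodable.encode (pad c)) y :=
    hF.comp (Computable.encode.comp (hpad.comp Computable.fst)) Computable.snd
  obtain ⟨c, hc⟩ := Code.fixed_point₂ hF'
  refine ⟨Encodable.encode (pad c), ?_, ?_⟩
  · have h₁ := strictMono_encode_const.le_apply (x := N)
    have h₂ := (Code.encode_lt_pair c (Code.const N)).2
    have h₃ := (Code.encode_lt_comp Code.left (Code.pair c (Code.const N))).2
    exact h₁.trans (h₂.trans h₃).le
  · rw [phi_encode]
    refine Eq.trans ?_ hc
    funext y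
    refine Part.ext fun a => ?_
    simp only [pad, Code.eval, Code.eval_const, Seq.seq, Part.map_eq_map]
    refine Part.mem_bind_iff.trans ?_
    simp

theorem exists_functional {test₁ : ℕ → List ℕ → Bool} {test₂ : ℕ → List ℕ → ℕ → Bool}
    {g h : ℕ → ℕ} (h₁ : Computable₂ test₁)
    (h₂ : Computable fun p : (ℕ × List ℕ) × ℕ => test₂ p.1.1 p.1.2 p.2)
    (hg : Computable g) (hh : Computable h) (N : ℕ) :
    ∃ x ≥ N, ∀ L w, (phi x (Nat.pair (Encodable.encode L) w)).Dom ↔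
      test₁ x L = true ∨ ∃ m ∈ phi (g x) (h x), test₂ x L m = true := by
  let G : ℕ × List ℕ →. ℕ := fun p => bif test₁ p.1 p.2 then Part.some 0 else
    (phi (g p.1) (h p.1)).bind fun m =>
      ((bif test₂ p.1 p.2 m then some 0 else none : Option ℕ) : Part ℕ)
  have hG : Partrec G := by
    refine Partrec.cond h₁ (Computable.const 0).partrec (Partrec.bind ?_ ?_)
    · exact partrec₂_phi.comp (hg.comp Computable.fst) (hh.comp Computable.fst)
    · exact Computable.ofOption (Computable.cond h₂ (Computable.const _) (Computable.const _))
  have hF : Partrec₂ fun x y : ℕ => G (x, Denumerable.ofNat (List ℕ) y.unpair.1) :=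
    hG.comp (Computable.fst.pair ((Computable.ofNat (List ℕ)).comp
      (Computable.fst.comp (Computable.unpair.comp Computable.snd))))
  obtain ⟨x, hx, hxF⟩ := exists_ge_phi_eq hF N
  refine ⟨x, hx, fun L w => ?_⟩
  simp only [hxF, Nat.unpair_pair, Denumerable.ofNat_encode, G]
  cases test₁ x L
  · simp only [cond_false, Bool.false_eq_true, false_or, Part.dom_iff_mem, Part.mem_bind_iff]
    constructor
    · rintro ⟨a, m, hm, ha⟩
      refine ⟨m, hm, ?_⟩
      by_contra hne
      simp only [Bool.eq_false_of_not_eq_true hne, cond_false] at ha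
      simp at ha
    · rintro ⟨m, hm, ht⟩
      exact ⟨0, m, hm, by simp [ht]⟩
  · simp

/-- Extends `L` by zeros, or truncates it, to length `n`. -/
def resize (L : List ℕ) (n : ℕ) : List ℕ := (List.range n).map fun k => L.getD k 0

theorem primrec₂_resize : Primrec₂ resize :=
  Primrec.list_map (Primrec.list_range.comp Primrec.snd)
    ((Primrec.list_getD 0).comp (Primrec.fst.comp Primrec.fst) Primrec.snd)

theorem resize_initSeg {A : Set ℕ} {v m n : ℕ} (hn : m < n) (hv : m ≤ v) :
    resize (initSeg (restrictTo A v) n) (m + 1) = initSeg A (m + 1) := by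
  refine List.map_congr_left fun k hk => ?_
  have hk : k < m + 1 := List.mem_range.1 hk
  rw [getD_initSeg, if_pos (by lia), chi_restrictTo_of_le (by lia)]

theorem resize_initSeg_succ (A : Set ℕ) (m n : ℕ) :
    resize (initSeg A (m + 1)) n = initSeg (restrictTo A m) n := by
  refine List.map_congr_left fun k _ => ?_
  rw [getD_initSeg]
  by_cases h : k ≤ m
  · rw [if_pos (by lia), chi_restrictTo_of_le h]
  · rw [if_neg (by lia), eq_comm, chi_eq_zero]
    exact fun hk => h hk.2

theorem exists_code_converges : ∃ c : ℕ, ∀ (e j : ℕ) (L : List ℕ),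
    (phi c (Nat.pair e (Nat.pair j (Encodable.encode L)))).Dom ↔
      ∃ n, (phi e (Nat.pair (Encodable.encode (resize L n)) j)).Dom := by
  let G : ℕ → ℕ → Option ℕ := fun y k => Code.evaln k.unpair.1
    (Denumerable.ofNat Code y.unpair.1)
    (Nat.pair (Encodable.encode (resize (Denumerable.ofNat (List ℕ) y.unpair.2.unpair.2)
      k.unpair.2)) y.unpair.2.unpair.1)
  have hG : Computable₂ G := by
    have hy : Primrec fun p : ℕ × ℕ => p.1.unpair := Primrec.unpair.comp Primrec.fst
    have hk : Primrec fun p : ℕ × ℕ => p.2.unpair := Primrec.unpair.comp Primrec.snd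
    have hz : Primrec fun p : ℕ × ℕ => p.1.unpair.2.unpair :=
      Primrec.unpair.comp (Primrec.snd.comp hy)
    have hr := primrec₂_resize.comp
      ((Primrec.ofNat (List ℕ)).comp (Primrec.snd.comp hz)) (Primrec.snd.comp hk)
    exact (Code.primrec_evaln.comp (((Primrec.fst.comp hk).pair
      ((Primrec.ofNat Code).comp (Primrec.fst.comp hy))).pair
      (Primrec₂.natPair.comp (Primrec.encode.comp hr) (Primrec.fst.comp hz)))).to_comp
  obtain ⟨c, hc⟩ := exists_phi_eq (Partrec.rfindOpt hG)
  refine ⟨c, fun e j L => ?_⟩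
  simp only [hc, Nat.rfindOpt_dom, G, Nat.unpair_pair, Denumerable.ofNat_encode]
  constructor
  · rintro ⟨k, a, ha⟩
    exact ⟨k.unpair.2, Part.dom_iff_mem.2 ⟨a, Code.evaln_complete.2 ⟨_, ha⟩⟩⟩
  · rintro ⟨n, hn⟩
    obtain ⟨a, ha⟩ := Part.dom_iff_mem.1 hn
    obtain ⟨s, hs⟩ := Code.evaln_complete.1 ha
    exact ⟨Nat.pair s n, a, by simpa using hs⟩

/-- `∅^{2b}` is not 1-reducible to `(∅^b)^{b₀}`. -/
theorem bIter_two_not_oneReducible_b0Jump :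
    ¬ oneReducible (bIter 2) (b0Jump (bJump ∅)) := by
  rintro ⟨f, hf, -, hred⟩
  obtain ⟨r, hr, hmono, hr_mem⟩ := exists_strictMono_reduction_halting
  obtain ⟨c, hc⟩ := exists_code_converges
  have hle : ∀ k, k ≤ r k := fun k => hmono.le_apply
  have hmarker : ∀ k, r (Nat.pair 0 k) ∈ bJump ∅ := fun k => (hr_mem 0 k).2 (phi_zero_dom k)
  have hmarker_le : ∀ k, k ≤ r (Nat.pair 0 k) := fun k => (Nat.right_le_pair 0 k).trans (hle _)
  let q : ℕ → ℕ := fun x => (f x).unpair.2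
  -- `r (q x) ∈ ∅^b` records convergence of the bound of `f x`; `query x σ ∈ ∅^b` records
  -- convergence of the functional of `f x` on the oracle `σ`.
  let query : ℕ → List ℕ → ℕ := fun x L =>
    r (Nat.pair c (Nat.pair (f x).unpair.1 (Nat.pair (q x).unpair.2 (Encodable.encode L))))
  let top : ℕ → ℕ → ℕ := fun x m => query x ((List.range (m + 1)).map fun _ => 1)
  let M₁ : ℕ → ℕ := fun x => r (Nat.pair 0 (r (q x)))
  let M₂ : ℕ → ℕ → ℕ := fun x m => r (Nat.pair 0 (top x m))
  let test₁ : ℕ → List ℕ → Bool := fun x L => L.getD (M₁ x) 0 == 1 && L.getD (r (q x)) 0 == 0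
  let test₂ : ℕ → List ℕ → ℕ → Bool := fun x L m =>
    L.getD (M₂ x m) 0 == 1 && L.getD (query x (resize L (m + 1))) 0 == 0
  have hq : Computable q := Computable.snd.comp (Computable.unpair.comp hf)
  have hquery : Computable₂ query := by
    refine hr.comp (Primrec₂.natPair.to_comp.comp (Computable.const c)
      (Primrec₂.natPair.to_comp.comp ?_ (Primrec₂.natPair.to_comp.comp ?_ ?_)))
    · exact Computable.fst.comp (Computable.unpair.comp (hf.comp Computable.fst))
    · exact Computable.snd.comp (Computable.unpair.comp (hq.comp Computable.fst))
    · exact Computable.encode.comp Computable.snd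
  have hones : Primrec fun m : ℕ => (List.range (m + 1)).map fun _ => 1 :=
    Primrec.list_map (Primrec.list_range.comp Primrec.succ) (Primrec.const 1).to₂
  have hM₁ : Computable M₁ :=
    hr.comp (Primrec₂.natPair.to_comp.comp (Computable.const 0) (hr.comp hq))
  have hM₂ : Computable₂ M₂ :=
    hr.comp (Primrec₂.natPair.to_comp.comp (Computable.const 0)
      (hquery.comp Computable.fst (hones.to_comp.comp Computable.snd)))
  have hgetD : Computable₂ fun (L : List ℕ) k => L.getD k 0 := (Primrec.list_getD 0).to_comp
  have hbeq : Computable₂ fun a b : ℕ => a == b := Primrec.beq.to_comp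
  have hand : Computable₂ (· && ·) := Primrec.and.to_comp
  have htest₁ : Computable₂ test₁ :=
    hand.comp
      (hbeq.comp (hgetD.comp Computable.snd (hM₁.comp Computable.fst)) (Computable.const 1))
      (hbeq.comp (hgetD.comp Computable.snd (hr.comp (hq.comp Computable.fst)))
        (Computable.const 0))
  have htest₂ : Computable fun p : (ℕ × List ℕ) × ℕ => test₂ p.1.1 p.1.2 p.2 := by
    have hx : Computable fun p : (ℕ × List ℕ) × ℕ => p.1.1 := Computable.fst.comp Computable.fst
    have hL : Computable fun p : (ℕ × List ℕ) × ℕ => p.1.2 := Computable.snd.comp Computable.fst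
    refine hand.comp
      (hbeq.comp (hgetD.comp hL (hM₂.comp hx Computable.snd)) (Computable.const 1))
      (hbeq.comp (hgetD.comp hL (hquery.comp hx ?_)) (Computable.const 0))
    exact primrec₂_resize.to_comp.comp hL (Computable.succ.comp Computable.snd)
  have hi : Computable fun x => (q x).unpair.1 := Computable.fst.comp (Computable.unpair.comp hq)
  have hj : Computable fun x => (q x).unpair.2 := Computable.snd.comp (Computable.unpair.comp hq)
  obtain ⟨i₁, hi₁⟩ := exists_phi_eq hM₁.partrec
  obtain ⟨i₂, hi₂⟩ := exists_phi_eq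
    ((partrec₂_phi.comp hi hj).map (g := M₂) hM₂)
  obtain ⟨x, hx, hdom⟩ := exists_functional htest₁ htest₂ hi hj (max i₁ i₂)
  have hxi₁ : i₁ ≤ x := (le_max_left _ _).trans hx
  have hxi₂ : i₂ ≤ x := (le_max_right _ _).trans hx
  have hmem : x ∈ bJump (bJump ∅) ↔ _ := mem_bJump
  simp only [hdom] at hmem
  have hqx : q x = Nat.pair (q x).unpair.1 (q x).unpair.2 := (Nat.pair_unpair _).symm
  have hfx : f x = Nat.pair (f x).unpair.1 (Nat.pair (q x).unpair.1 (q x).unpair.2) := by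
    rw [← hqx, Nat.pair_unpair]
  have hrq : r (q x) ∈ bJump ∅ ↔ (phi (q x).unpair.1 (q x).unpair.2).Dom := by
    conv_lhs => rw [hqx]
    exact hr_mem _ _
  have hred_x : x ∈ bJump (bJump ∅) ↔ f x ∈ b0Jump (bJump ∅) := hred x
  rw [hfx, pair_mem_b0Jump] at hred_x
  obtain ⟨m, hm⟩ : ∃ m, m ∈ phi (q x).unpair.1 (q x).unpair.2 := by
    rw [← Part.dom_iff_mem, ← hrq]
    by_contra hnot
    have hin : x ∈ bJump (bJump ∅) := by
      refine hmem.2 ⟨i₁, hxi₁, M₁ x, by simp [hi₁], M₁ x + 1, Or.inl ?_⟩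
      have hlt : r (q x) ≤ M₁ x := hmarker_le _
      simp only [test₁, Bool.and_eq_true, beq_iff_eq, getD_initSeg]
      rw [if_pos (by lia), if_pos (by lia), chi_restrictTo_of_le le_rfl,
        chi_restrictTo_of_le hlt, chi_eq_one, chi_eq_zero]
      exact ⟨hmarker _, hnot⟩
    obtain ⟨m, hm, -⟩ := hred_x.1 hin
    exact hnot (hrq.2 (Part.dom_iff_mem.2 ⟨m, hm⟩))
  have hquery_le : query x (initSeg (bJump ∅) (m + 1)) ≤ top x m :=
    hmono.monotone (Nat.pair_mono le_rfl (Nat.pair_mono le_rfl (Nat.pair_mono le_rfl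
      (encode_map_le (chi_le_one _)))))
  have htop_le : top x m ≤ M₂ x m := hmarker_le _
  have hm_le : m ≤ top x m := by
    have h₁ := Encodable.length_le_encode ((List.range (m + 1)).map fun _ => 1)
    simp only [List.length_map, List.length_range] at h₁
    exact (Nat.le_succ m).trans (h₁.trans ((Nat.right_le_pair _ _).trans
      ((Nat.right_le_pair _ _).trans ((Nat.right_le_pair _ _).trans (hle _)))))
  have hout : x ∈ bJump (bJump ∅) ↔ query x (initSeg (bJump ∅) (m + 1)) ∉ bJump ∅ := by
    rw [hmem]
    constructor
    · rintro ⟨_, _, v, _, n, h | ⟨m', hm', h⟩⟩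
      · simp only [test₁, Bool.and_eq_true, beq_iff_eq, getD_initSeg] at h
        have hlt : r (q x) ≤ M₁ x := hmarker_le _
        have hn : M₁ x < n := by
          by_contra hn
          simp [hn] at h
        rw [if_pos hn, if_pos (by lia), chi_eq_one] at h
        rw [chi_restrictTo_of_le (hlt.trans h.1.2), chi_eq_zero, hrq] at h
        exact absurd (Part.dom_iff_mem.2 ⟨m, hm⟩) h.2
      · obtain rfl := Part.mem_unique hm hm'
        simp only [test₂, Bool.and_eq_true, beq_iff_eq] at h
        rw [getD_initSeg] at h
        have hn : M₂ x m < n := by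
          by_contra hn
          simp [hn] at h
        rw [if_pos hn, chi_eq_one] at h
        have hv : M₂ x m ≤ v := h.1.2
        rw [resize_initSeg (by lia) (by lia), getD_initSeg, if_pos (by lia),
          chi_restrictTo_of_le (by lia), chi_eq_zero] at h
        exact h.2
    · intro h
      refine ⟨i₂, hxi₂, M₂ x m, ?_, M₂ x m + 1, Or.inr ⟨m, hm, ?_⟩⟩
      · rw [hi₂]
        exact Part.mem_map _ hm
      · simp only [test₂, Bool.and_eq_true, beq_iff_eq]
        rw [resize_initSeg (by lia) (by lia), getD_initSeg, getD_initSeg, if_pos (by lia),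
          if_pos (by lia), chi_restrictTo_of_le le_rfl, chi_restrictTo_of_le (by lia),
          chi_eq_one, chi_eq_zero]
        exact ⟨hmarker _, h⟩
  have hin : x ∈ bJump (bJump ∅) ↔ query x (initSeg (bJump ∅) (m + 1)) ∈ bJump ∅ := by
    simp only [hred_x, query, hr_mem, hc, resize_initSeg_succ]
    constructor
    · rintro ⟨m', hm', h⟩
      obtain rfl := Part.mem_unique hm hm'
      exact h
    · exact fun h => ⟨m, hm, h⟩
  exact iff_not_self (hin.symm.trans hout)
end
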